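/- Let D ≥ 1, ζ, λ > 0, and p ∈ [0,1]. Consider the game in which the source law μ_X ranges over all probability laws of ℝ^D-valued random vectors X with finite second moments and Tr Cov(X) ≤ Dζ², and the noise law μ_N ranges over all probability laws of ℝ^D-valued random vectors N with finite second moments and Tr Cov(N) ≤ Dλ², with X and N independent. Then sup over μ_X of inf over μ_N of I(X; X + N) equals (D/2)·ln(1 + ζ²/λ²) nats; consequently, the maximal peer-to-peer information leakage over a link that delivers the masked update X + N with probability 1 − p and nothing otherwise equals (1 − p)·(D/2)·ln(1 + ζ²/λ²) nats. -/

import Mathlib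

open Finset MeasureTheory ProbabilityTheory Real
open scoped NNReal ENNReal Classical

/-- The Kullback–Leibler divergence `KL(μ ‖ ν)`, in nats, valued in `EReal`. -/
noncomputable def klDiv {α : Type*} [MeasurableSpace α] (μ ν : Measure α) : EReal :=
  if μ ≪ ν ∧ Integrable (llr μ ν) μ then ((∫ x, llr μ ν x ∂μ : ℝ) : EReal) else ⊤

/-- The mutual information of a joint law `ρ` on `α × β`, in nats. -/
noncomputable def mutualInfo {α β : Type*} [MeasurableSpace α] [MeasurableSpace β]
    (ρ : Measure (α × β)) : EReal :=
  klDiv ρ ((ρ.map Prod.fst).prod (ρ.map Prod.snd))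

/-- Probability laws on `ℝ^D` with finite second moments and trace of covariance at
most `D·σ²`. -/
def PowerConstrained (D : ℕ) (σ2 : ℝ) : Type :=
  {μ : Measure (Fin D → ℝ) // IsProbabilityMeasure μ ∧
    (∀ d, MemLp (fun x => x d) 2 μ) ∧
    ∑ d, variance (fun x => x d) μ ≤ (D : ℝ) * σ2}

/-- The mutual information `I(X; X + N)` when `X` and `N` are independent with laws
`μX` and `μN`: the joint law of `(X, X + N)` is the pushforward of `μX.prod μN`
under `(x, n) ↦ (x, x + n)`. -/
noncomputable def leakage {D : ℕ} (μX μN : Measure (Fin D → ℝ)) : EReal :=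
  mutualInfo ((μX.prod μN).map fun q => (q.1, q.1 + q.2))

section Gibbs

variable {α : Type*} [MeasurableSpace α] {ρ ν : Measure α} {f : α → ℝ≥0∞} {g : α → ℝ}

lemma ae_ne_zero_and_ne_top_of_eq_withDensity [IsFiniteMeasure ρ] (hf : Measurable f)
    (hρ : ρ = ν.withDensity f) : ∀ᵐ x ∂ρ, f x ≠ 0 ∧ f x ≠ ⊤ := by
  have h1 : ∫⁻ x, f x ∂ν ≠ ⊤ := by
    have := measure_ne_top ρ Set.univ
    rwa [hρ, withDensity_apply _ MeasurableSet.univ, Measure.restrict_univ] at this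
  rw [hρ, ae_withDensity_iff hf]
  filter_upwards [ae_lt_top hf h1] with x hx h0
  exact ⟨h0, hx.ne⟩

lemma integrable_div_density_and_integral_le_one (hf : Measurable f)
    (hρ : ρ = ν.withDensity f) (hgm : Measurable g) (hg0 : ∀ x, 0 < g x)
    (hg1 : ∫⁻ x, ENNReal.ofReal (g x) ∂ν ≤ 1) :
    Integrable (fun x => g x / (f x).toReal) ρ ∧ ∫ x, g x / (f x).toReal ∂ρ ≤ 1 := by
  have hnn : ∀ x, 0 ≤ g x / (f x).toReal := fun x =>
    div_nonneg (hg0 x).le ENNReal.toReal_nonneg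
  have hm : Measurable fun x => g x / (f x).toReal := hgm.div hf.ennreal_toReal
  have hle : ∫⁻ x, ENNReal.ofReal (g x / (f x).toReal) ∂ρ ≤ 1 := by
    rw [hρ, lintegral_withDensity_eq_lintegral_mul _ hf hm.ennreal_ofReal]
    refine (lintegral_mono fun x => ?_).trans hg1
    simp only [Pi.mul_apply]
    by_cases h0 : f x = 0
    · simp [h0]
    by_cases ht : f x = ⊤
    · simp [ht]
    have hpos : 0 < (f x).toReal := ENNReal.toReal_pos h0 ht
    rw [ENNReal.ofReal_div_of_pos hpos, ENNReal.ofReal_toReal ht, ENNReal.mul_div_cancel h0 ht]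
  refine ⟨⟨hm.aestronglyMeasurable, ?_⟩, ?_⟩
  · rw [hasFiniteIntegral_iff_ofReal (ae_of_all _ hnn)]
    exact hle.trans_lt ENNReal.one_lt_top
  · rw [integral_eq_lintegral_of_nonneg_ae (ae_of_all _ hnn) hm.aestronglyMeasurable]
    exact ENNReal.toReal_le_of_le_ofReal zero_le_one (by simpa using hle)

lemma ae_log_sub_log_density_le [IsFiniteMeasure ρ] (hf : Measurable f)
    (hρ : ρ = ν.withDensity f) (hg0 : ∀ x, 0 < g x) :
    ∀ᵐ x ∂ρ, log (g x) - log (f x).toReal ≤ g x / (f x).toReal - 1 := by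
  filter_upwards [ae_ne_zero_and_ne_top_of_eq_withDensity hf hρ] with x ⟨h0, ht⟩
  have hpos : 0 < (f x).toReal := ENNReal.toReal_pos h0 ht
  rw [← log_div (hg0 x).ne' hpos.ne']
  exact log_le_sub_one_of_pos (div_pos (hg0 x) hpos)

/-- **Gibbs' inequality**: the cross entropy of a subprobability density is at least the
entropy. -/
lemma integral_log_le_integral_log_density [IsProbabilityMeasure ρ] (hf : Measurable f)
    (hρ : ρ = ν.withDensity f) (hgm : Measurable g) (hg0 : ∀ x, 0 < g x)
    (hg1 : ∫⁻ x, ENNReal.ofReal (g x) ∂ν ≤ 1) (hgi : Integrable (fun x => log (g x)) ρ)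
    (hfi : Integrable (fun x => log (f x).toReal) ρ) :
    ∫ x, log (g x) ∂ρ ≤ ∫ x, log (f x).toReal ∂ρ := by
  obtain ⟨hZ, hZ1⟩ := integrable_div_density_and_integral_le_one hf hρ hgm hg0 hg1
  have h := integral_mono_ae (hgi.sub hfi) (hZ.sub (integrable_const 1))
    (ae_log_sub_log_density_le hf hρ hg0)
  simp only [Pi.sub_apply] at h
  rw [integral_sub hgi hfi, integral_sub hZ (integrable_const 1)] at h
  simp at h
  linarith

lemma integrable_log_density_of_le [IsProbabilityMeasure ρ] (hf : Measurable f)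
    (hρ : ρ = ν.withDensity f) (hgm : Measurable g) (hg0 : ∀ x, 0 < g x)
    (hg1 : ∫⁻ x, ENNReal.ofReal (g x) ∂ν ≤ 1) (hgi : Integrable (fun x => log (g x)) ρ)
    {C : ℝ} (hC : ∀ᵐ x ∂ρ, log (f x).toReal ≤ C) :
    Integrable (fun x => log (f x).toReal) ρ := by
  obtain ⟨hZ, -⟩ := integrable_div_density_and_integral_le_one hf hρ hgm hg0 hg1
  refine integrable_of_le_of_le hf.ennreal_toReal.log.aestronglyMeasurable
    (g₁ := fun x => log (g x) - (g x / (f x).toReal - 1)) (g₂ := fun _ => C) ?_ hC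
    (hgi.sub (hZ.sub (integrable_const 1))) (integrable_const C)
  filter_upwards [ae_log_sub_log_density_le hf hρ hg0] with x hx
  linarith

/-- The Gibbs variational lower bound for the divergence. -/
lemma integral_log_le_klDiv [IsProbabilityMeasure ρ] [SigmaFinite ν]
    (hgm : Measurable g) (hg0 : ∀ x, 0 < g x)
    (hg1 : ∫⁻ x, ENNReal.ofReal (g x) ∂ν ≤ 1) (hgi : Integrable (fun x => log (g x)) ρ) :
    ((∫ x, log (g x) ∂ρ : ℝ) : EReal) ≤ klDiv ρ ν := by
  unfold klDiv
  split_ifs with h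
  · exact EReal.coe_le_coe_iff.2 (integral_log_le_integral_log_density
      (Measure.measurable_rnDeriv ρ ν) (Measure.withDensity_rnDeriv_eq ρ ν h.1).symm
      hgm hg0 hg1 hgi h.2)
  · exact le_top

end Gibbs

section AdditiveNoise

variable {D : ℕ} {μ γ : Measure (Fin D → ℝ)}

lemma leakage_eq_klDiv [IsProbabilityMeasure μ] [IsProbabilityMeasure γ] :
    leakage μ γ = klDiv ((μ.prod γ).map fun q => (q.1, q.1 + q.2))
      (μ.prod ((μ.prod γ).map fun q => q.1 + q.2)) := by
  unfold leakage mutualInfo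
  rw [Measure.map_map measurable_fst (by fun_prop), Measure.map_map measurable_snd (by fun_prop)]
  congr 2
  exact Measure.map_fst_prod.trans (by simp)

/-- The leakage through noise with a bounded positive density `ψ` is at most the entropy gap
between the noise and any reference output density `g`. -/
lemma leakage_le_integral_log_sub [IsProbabilityMeasure μ] [IsProbabilityMeasure γ]
    {ψ g : (Fin D → ℝ) → ℝ} (hψm : Measurable ψ) (hψ0 : ∀ x, 0 < ψ x) {C : ℝ}
    (hψC : ∀ x, ψ x ≤ C) (hγ : γ = volume.withDensity fun x => ENNReal.ofReal (ψ x))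
    (hψi : Integrable (fun x => log (ψ x)) γ)
    (hgm : Measurable g) (hg0 : ∀ x, 0 < g x)
    (hg1 : ∫⁻ x, ENNReal.ofReal (g x) ≤ 1)
    (hgi : Integrable (fun q : (Fin D → ℝ) × (Fin D → ℝ) => log (g (q.1 + q.2))) (μ.prod γ)) :
    leakage μ γ ≤ ((∫ n, log (ψ n) ∂γ - ∫ q, log (g (q.1 + q.2)) ∂(μ.prod γ) : ℝ) : EReal) := by
  have hT : Measurable fun q : (Fin D → ℝ) × (Fin D → ℝ) => (q.1, q.1 + q.2) := by fun_prop
  have hA : Measurable fun q : (Fin D → ℝ) × (Fin D → ℝ) => q.1 + q.2 := by fun_prop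
  set ρ := (μ.prod γ).map fun q => (q.1, q.1 + q.2) with hρ
  set η := (μ.prod γ).map fun q => q.1 + q.2 with hη
  have : IsProbabilityMeasure ρ := Measure.isProbabilityMeasure_map hT.aemeasurable
  have : IsProbabilityMeasure η := Measure.isProbabilityMeasure_map hA.aemeasurable
  set H : (Fin D → ℝ) → ℝ≥0∞ := fun y => ∫⁻ x, ENNReal.ofReal (ψ (y - x)) ∂μ with hH
  have hHm : Measurable H := by
    refine Measurable.lintegral_prod_right' (f := fun p : (Fin D → ℝ) × (Fin D → ℝ) =>
      ENNReal.ofReal (ψ (p.1 - p.2))) ?_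
    fun_prop
  have hHC : ∀ y, H y ≤ ENNReal.ofReal C := fun y => by
    refine (lintegral_mono fun x => ENNReal.ofReal_le_ofReal (hψC _)).trans ?_
    simp
  have hHtop : ∀ y, H y ≠ ⊤ := fun y => ((hHC y).trans_lt ENNReal.ofReal_lt_top).ne
  have hH0 : ∀ y, H y ≠ 0 := fun y h => by
    rw [hH, lintegral_eq_zero_iff (by fun_prop)] at h
    obtain ⟨x, hx⟩ := h.exists
    exact absurd hx (by simpa using hψ0 _)
  have hlint : ∀ F : (Fin D → ℝ) × (Fin D → ℝ) → ℝ≥0∞, Measurable F →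
      ∫⁻ z, F z ∂ρ = ∫⁻ x, (∫⁻ y, ENNReal.ofReal (ψ (y - x)) * F (x, y)) ∂μ := by
    intro F hF
    rw [hρ, lintegral_map hF hT, lintegral_prod _ (by fun_prop)]
    refine lintegral_congr fun x => ?_
    rw [hγ, lintegral_withDensity_eq_lintegral_mul _ (by fun_prop) (by fun_prop),
      ← lintegral_sub_right_eq_self _ x]
    simp
  have hηH : η = volume.withDensity H := by
    refine Measure.ext_of_lintegral _ fun F hF => ?_
    have hηρ : η = ρ.map Prod.snd := by
      rw [hρ, Measure.map_map measurable_snd hT]; rfl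
    rw [hηρ, lintegral_map hF measurable_snd, hlint (fun z => F z.2) (hF.comp measurable_snd),
      lintegral_withDensity_eq_lintegral_mul _ hHm hF, lintegral_lintegral_swap (by fun_prop)]
    exact lintegral_congr fun y => lintegral_mul_const (F y) (by fun_prop)
  set k : (Fin D → ℝ) × (Fin D → ℝ) → ℝ≥0∞ :=
    fun z => ENNReal.ofReal (ψ (z.2 - z.1)) / H z.2 with hk
  have hkm : Measurable k := by fun_prop
  have hρk : ρ = (μ.prod η).withDensity k := by
    refine Measure.ext_of_lintegral _ fun F hF => ?_
    rw [hlint F hF, lintegral_withDensity_eq_lintegral_mul _ hkm hF,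
      lintegral_prod _ (by fun_prop)]
    refine lintegral_congr fun x => ?_
    rw [hηH, lintegral_withDensity_eq_lintegral_mul _ hHm (by fun_prop)]
    refine lintegral_congr fun y => ?_
    simp only [Pi.mul_apply, hk]
    rw [← mul_assoc, ENNReal.mul_div_cancel (hH0 y) (hHtop y)]
  have hac : ρ ≪ μ.prod η := hρk ▸ withDensity_absolutelyContinuous _ _
  have hllr : llr ρ (μ.prod η) =ᵐ[ρ] fun z => log (ψ (z.2 - z.1)) - log (H z.2).toReal := by
    have h := hac.ae_eq (Measure.rnDeriv_withDensity (μ.prod η) hkm)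
    rw [← hρk] at h
    filter_upwards [h] with z hz
    rw [llr, hz, hk, ENNReal.toReal_div, ENNReal.toReal_ofReal (hψ0 _).le,
      log_div (hψ0 _).ne' (ENNReal.toReal_pos (hH0 _) (hHtop _)).ne']
  have hlgη : Integrable (fun y => log (g y)) η :=
    (integrable_map_measure hgm.log.aestronglyMeasurable hA.aemeasurable).2 hgi
  have hHi : Integrable (fun y => log (H y).toReal) η := by
    refine integrable_log_density_of_le hHm hηH hgm hg0 hg1 hlgη (C := log C)
      (ae_of_all _ fun y => ?_)
    refine log_le_log (ENNReal.toReal_pos (hH0 y) (hHtop y)) ?_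
    exact ENNReal.toReal_le_of_le_ofReal ((hψ0 0).le.trans (hψC 0)) (hHC y)
  have hgibbs := integral_log_le_integral_log_density hHm hηH hgm hg0 hg1 hlgη hHi
  have hHA : Integrable (fun q : (Fin D → ℝ) × (Fin D → ℝ) => log (H (q.1 + q.2)).toReal)
      (μ.prod γ) :=
    (integrable_map_measure hHm.ennreal_toReal.log.aestronglyMeasurable hA.aemeasurable).1 hHi
  have hψs : Integrable (fun q : (Fin D → ℝ) × (Fin D → ℝ) => log (ψ q.2)) (μ.prod γ) :=
    hψi.comp_snd μ
  have hdm : Measurable fun z : (Fin D → ℝ) × (Fin D → ℝ) =>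
      log (ψ (z.2 - z.1)) - log (H z.2).toReal :=
    (hψm.comp (by fun_prop)).log.sub (hHm.comp measurable_snd).ennreal_toReal.log
  have hint : Integrable (llr ρ (μ.prod η)) ρ := by
    rw [integrable_congr hllr, hρ, integrable_map_measure hdm.aestronglyMeasurable hT.aemeasurable]
    simpa [Function.comp_def, Pi.sub_def] using hψs.sub hHA
  rw [leakage_eq_klDiv, klDiv, if_pos ⟨hac, hint⟩, EReal.coe_le_coe_iff, integral_congr_ae hllr,
    hρ, integral_map hT.aemeasurable hdm.aestronglyMeasurable]
  simp only [add_sub_cancel_left]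
  rw [integral_sub hψs hHA, integral_fun_snd (μ := μ) (ν := γ) (fun n => log (ψ n))]
  rw [hη, integral_map hA.aemeasurable hgm.log.aestronglyMeasurable,
    integral_map hA.aemeasurable hHm.ennreal_toReal.log.aestronglyMeasurable] at hgibbs
  simp only [probReal_univ, one_smul]
  linarith

end AdditiveNoise

section GaussianPi

variable {D : ℕ}

/-- The density of the law on `ℝ^D` with independent Gaussian coordinates of means `m d` and
common variance `v`. -/
noncomputable def gaussianPiPDFReal (m : Fin D → ℝ) (v : ℝ≥0) (x : Fin D → ℝ) : ℝ :=
  ∏ d, gaussianPDFReal (m d) v (x d)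

/-- The law on `ℝ^D` with independent centered Gaussian coordinates of variance `v`. -/
noncomputable def gaussianPi (D : ℕ) (v : ℝ≥0) : Measure (Fin D → ℝ) :=
  Measure.pi fun _ => gaussianReal 0 v

instance (v : ℝ≥0) : IsProbabilityMeasure (gaussianPi D v) := by
  unfold gaussianPi; infer_instance

lemma gaussianPiPDFReal_pos (m : Fin D → ℝ) {v : ℝ≥0} (hv : v ≠ 0) (x : Fin D → ℝ) :
    0 < gaussianPiPDFReal m v x :=
  Finset.prod_pos fun _ _ => gaussianPDFReal_pos _ _ _ hv

lemma measurable_gaussianPiPDFReal_uncurry (v : ℝ≥0) :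
    Measurable fun q : (Fin D → ℝ) × (Fin D → ℝ) => gaussianPiPDFReal q.1 v q.2 := by
  unfold gaussianPiPDFReal gaussianPDFReal
  fun_prop

lemma measurable_gaussianPiPDFReal (m : Fin D → ℝ) (v : ℝ≥0) :
    Measurable (gaussianPiPDFReal m v) := by
  unfold gaussianPiPDFReal gaussianPDFReal
  fun_prop

lemma gaussianPiPDFReal_le (m : Fin D → ℝ) (v : ℝ≥0) (x : Fin D → ℝ) :
    gaussianPiPDFReal m v x ≤ ∏ _d : Fin D, (√(2 * π * v))⁻¹ := by
  refine Finset.prod_le_prod (fun _ _ => gaussianPDFReal_nonneg _ _ _) fun d _ => ?_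
  refine mul_le_of_le_one_right (by positivity) (exp_le_one_iff.2 ?_)
  exact div_nonpos_of_nonpos_of_nonneg (by nlinarith [sq_nonneg (x d - m d)]) (by positivity)

lemma log_gaussianPDFReal (m : ℝ) {v : ℝ≥0} (hv : v ≠ 0) (x : ℝ) :
    log (gaussianPDFReal m v x) = -(1 / 2 * log (2 * π * v)) - (x - m) ^ 2 / (2 * v) := by
  have hv' : (0 : ℝ) < v := NNReal.coe_pos.2 (pos_iff_ne_zero.2 hv)
  rw [gaussianPDFReal, log_mul (by positivity) (exp_pos _).ne', log_exp, log_inv,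
    log_sqrt (by positivity)]
  ring

lemma log_gaussianPiPDFReal (m : Fin D → ℝ) {v : ℝ≥0} (hv : v ≠ 0) (x : Fin D → ℝ) :
    log (gaussianPiPDFReal m v x) =
      ∑ d, (-(1 / 2 * log (2 * π * v)) - (x d - m d) ^ 2 / (2 * v)) := by
  rw [gaussianPiPDFReal, log_prod fun d _ => (gaussianPDFReal_pos _ _ _ hv).ne']
  exact Finset.sum_congr rfl fun d _ => log_gaussianPDFReal _ hv _

lemma pi_gaussianReal_eq_withDensity (m : Fin D → ℝ) {v : ℝ≥0} (hv : v ≠ 0) :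
    (Measure.pi fun d => gaussianReal (m d) v) =
      volume.withDensity fun x => ENNReal.ofReal (gaussianPiPDFReal m v x) := by
  refine Measure.pi_eq fun s hs => ?_
  have hi : ∀ d, Integrable ((s d).indicator (gaussianPDFReal (m d) v)) := fun d =>
    (integrable_gaussianPDFReal _ _).indicator (hs d)
  have hnn : ∀ d x, 0 ≤ (s d).indicator (gaussianPDFReal (m d) v) x := fun d x =>
    Set.indicator_nonneg (fun _ _ => gaussianPDFReal_nonneg _ _ _) x
  have hpi : ∀ x : Fin D → ℝ,
      (Set.univ.pi s).indicator (fun x => ENNReal.ofReal (gaussianPiPDFReal m v x)) x =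
      ENNReal.ofReal (∏ d, (s d).indicator (gaussianPDFReal (m d) v) (x d)) := by
    intro x
    by_cases hx : x ∈ Set.univ.pi s
    · rw [Set.indicator_of_mem hx, gaussianPiPDFReal]
      congr 1
      exact Finset.prod_congr rfl fun d _ => (Set.indicator_of_mem (hx d trivial) _).symm
    · rw [Set.indicator_of_notMem hx]
      obtain ⟨d, hd⟩ : ∃ d, x d ∉ s d := by simpa [Set.mem_pi] using hx
      rw [Finset.prod_eq_zero (Finset.mem_univ d) (Set.indicator_of_notMem hd _)]
      simp
  have hprod : Integrable fun x : Fin D → ℝ =>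
      ∏ d, (s d).indicator (gaussianPDFReal (m d) v) (x d) := Integrable.fintype_prod hi
  rw [withDensity_apply _ (MeasurableSet.univ_pi hs),
    ← lintegral_indicator (MeasurableSet.univ_pi hs), lintegral_congr hpi,
    ← ofReal_integral_eq_lintegral_ofReal hprod
      (ae_of_all _ fun x => Finset.prod_nonneg fun d _ => hnn d _),
    integral_fintype_prod_volume_eq_prod,
    ENNReal.ofReal_prod_of_nonneg fun d _ => integral_nonneg (hnn d)]
  refine Finset.prod_congr rfl fun d _ => ?_
  rw [gaussianReal_apply_eq_integral _ hv, integral_indicator (hs d)]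

lemma gaussianPi_eq_withDensity {v : ℝ≥0} (hv : v ≠ 0) :
    gaussianPi D v = volume.withDensity fun x => ENNReal.ofReal (gaussianPiPDFReal 0 v x) :=
  pi_gaussianReal_eq_withDensity 0 hv

lemma lintegral_gaussianPiPDFReal (m : Fin D → ℝ) {v : ℝ≥0} (hv : v ≠ 0) :
    ∫⁻ x, ENNReal.ofReal (gaussianPiPDFReal m v x) = 1 := by
  have h : (Measure.pi fun d => gaussianReal (m d) v) Set.univ = 1 := measure_univ
  rwa [pi_gaussianReal_eq_withDensity m hv, withDensity_apply _ MeasurableSet.univ,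
    Measure.restrict_univ] at h

lemma lintegral_gaussianPi_div {v w : ℝ≥0} (hv : v ≠ 0) (hw : w ≠ 0) (m : Fin D → ℝ) :
    ∫⁻ x, ENNReal.ofReal (gaussianPiPDFReal m v x / gaussianPiPDFReal 0 w x)
      ∂(gaussianPi D w) = 1 := by
  have h1 := measurable_gaussianPiPDFReal m v
  have h2 := measurable_gaussianPiPDFReal (0 : Fin D → ℝ) w
  rw [gaussianPi_eq_withDensity hw,
    lintegral_withDensity_eq_lintegral_mul _ h2.ennreal_ofReal (by fun_prop),
    ← lintegral_gaussianPiPDFReal m hv]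
  refine lintegral_congr fun x => ?_
  have hpos := gaussianPiPDFReal_pos 0 hw x
  rw [Pi.mul_apply, ← ENNReal.ofReal_mul hpos.le, mul_div_cancel₀ _ hpos.ne']

lemma memLp_eval_gaussianPi (v : ℝ≥0) (d : Fin D) :
    MemLp (fun x => x d) 2 (gaussianPi D v) :=
  (memLp_id_gaussianReal 2).comp_measurePreserving
    (measurePreserving_eval (fun _ : Fin D => gaussianReal 0 v) d)

lemma integral_eval_gaussianPi (v : ℝ≥0) (d : Fin D) :
    ∫ x, x d ∂(gaussianPi D v) = 0 := by
  rw [gaussianPi, integral_eval, integral_id_gaussianReal]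

lemma integral_eval_sq_gaussianPi (v : ℝ≥0) (d : Fin D) :
    ∫ x, x d ^ 2 ∂(gaussianPi D v) = v := by
  have h : ∫ x, x ^ 2 ∂(gaussianReal 0 v) = v := by
    have := variance_id_gaussianReal (μ := 0) (v := v)
    rw [variance_eq_integral measurable_id.aemeasurable] at this
    simpa [integral_id_gaussianReal] using this
  rw [gaussianPi, ← h]
  exact integral_comp_eval (μ := fun _ : Fin D => gaussianReal 0 v) (i := d)
    (f := fun t : ℝ => t ^ 2) (by fun_prop)

lemma sum_variance_gaussianPi (v : ℝ≥0) :
    ∑ d, variance (fun x => x d) (gaussianPi D v) = D * v := by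
  have h : ∀ d : Fin D, variance (fun x => x d) (gaussianPi D v) = v := fun d => by
    rw [variance_eq_integral (measurable_pi_apply d).aemeasurable, integral_eval_gaussianPi]
    simpa using integral_eval_sq_gaussianPi v d
  simp [h]

end GaussianPi

section Moments

variable {α β : Type*} [MeasurableSpace α] [MeasurableSpace β] {μ : Measure α} {ν : Measure β}
  [IsProbabilityMeasure μ] [IsProbabilityMeasure ν] {u : α → ℝ} {w : β → ℝ}

lemma memLp_two_fst_add_snd (hu : MemLp u 2 μ) (hw : MemLp w 2 ν) :
    MemLp (fun q : α × β => u q.1 + w q.2) 2 (μ.prod ν) :=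
  (hu.comp_fst ν).add (hw.comp_snd μ)

lemma integral_fst_add_snd_sq (hu : MemLp u 2 μ) (hw : MemLp w 2 ν) (hw0 : ∫ y, w y ∂ν = 0) :
    ∫ q, (u q.1 + w q.2) ^ 2 ∂(μ.prod ν) = ∫ x, u x ^ 2 ∂μ + ∫ y, w y ^ 2 ∂ν := by
  have h1 : Integrable (fun q : α × β => u q.1 ^ 2) (μ.prod ν) := hu.integrable_sq.comp_fst ν
  have h2 : Integrable (fun q : α × β => w q.2 ^ 2) (μ.prod ν) := hw.integrable_sq.comp_snd μ
  have h3 : Integrable (fun q : α × β => 2 * (u q.1 * w q.2)) (μ.prod ν) :=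
    ((hu.integrable one_le_two).mul_prod (hw.integrable one_le_two)).const_mul 2
  have h12 : Integrable (fun q : α × β => u q.1 ^ 2 + w q.2 ^ 2) (μ.prod ν) := h1.add h2
  have h : ∀ q : α × β, (u q.1 + w q.2) ^ 2 = u q.1 ^ 2 + w q.2 ^ 2 + 2 * (u q.1 * w q.2) :=
    fun q => by ring
  rw [integral_congr_ae (ae_of_all _ h), integral_add h12 h3, integral_add h1 h2,
    integral_const_mul, integral_prod_mul, hw0, integral_fun_fst (fun x => u x ^ 2),
    integral_fun_snd (fun y => w y ^ 2)]
  simp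

end Moments

section GaussianSaddlePoint

variable {D : ℕ} {v w : ℝ≥0} {μ : Measure (Fin D → ℝ)} [IsProbabilityMeasure μ]

lemma memLp_eval_sub_integral (hμ : ∀ d, MemLp (fun x : Fin D → ℝ => x d) 2 μ) (d : Fin D) :
    MemLp (fun x : Fin D → ℝ => x d - ∫ x', x' d ∂μ) 2 μ :=
  (hμ d).sub (memLp_const _)

lemma integral_eval_sub_integral (hμ : ∀ d, MemLp (fun x : Fin D → ℝ => x d) 2 μ) (d : Fin D) :
    ∫ x : Fin D → ℝ, (x d - ∫ x', x' d ∂μ) ∂μ = 0 := by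
  rw [integral_sub ((hμ d).integrable one_le_two) (integrable_const _)]
  simp

/-- Gaussian noise of variance `v` bounds the leakage of every source of power `w`. -/
lemma leakage_gaussianPi_le (hv : v ≠ 0) (hμ : ∀ d, MemLp (fun x : Fin D → ℝ => x d) 2 μ)
    (hvar : ∑ d, variance (fun x : Fin D → ℝ => x d) μ ≤ D * w) :
    leakage μ (gaussianPi D v) ≤ ((D / 2 * log (1 + w / v) : ℝ) : EReal) := by
  have hv' : (0 : ℝ) < v := NNReal.coe_pos.2 (pos_iff_ne_zero.2 hv)
  have hwv : w + v ≠ 0 := by simp [hv]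
  have hwv' : (0 : ℝ) < w + v := by positivity
  set m : Fin D → ℝ := fun d => ∫ x, x d ∂μ
  have hn := memLp_eval_gaussianPi (D := D) v
  have hc : ∀ d, MemLp (fun x : Fin D → ℝ => x d - m d) 2 μ := memLp_eval_sub_integral hμ
  have hsum : ∀ q : (Fin D → ℝ) × (Fin D → ℝ), ∀ d,
      (q.1 + q.2) d - m d = q.1 d - m d + q.2 d := fun q d => by
    rw [Pi.add_apply]; ring
  have hψi : ∀ d, Integrable (fun n : Fin D → ℝ =>
      -(1 / 2 * log (2 * π * v)) - (n d - (0 : Fin D → ℝ) d) ^ 2 / (2 * v)) (gaussianPi D v) := by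
    intro d
    simp only [Pi.zero_apply, sub_zero]
    exact (integrable_const _).sub ((hn d).integrable_sq.div_const _)
  have hgi : ∀ d, Integrable (fun q : (Fin D → ℝ) × (Fin D → ℝ) =>
      -(1 / 2 * log (2 * π * (w + v : ℝ≥0))) - ((q.1 + q.2) d - m d) ^ 2 / (2 * (w + v : ℝ≥0)))
      (μ.prod (gaussianPi D v)) := by
    intro d
    simp only [hsum]
    exact (integrable_const _).sub ((memLp_two_fst_add_snd (hc d) (hn d)).integrable_sq.div_const _)
  refine (leakage_le_integral_log_sub (ψ := gaussianPiPDFReal 0 v)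
    (g := gaussianPiPDFReal m (w + v)) (measurable_gaussianPiPDFReal 0 v)
    (gaussianPiPDFReal_pos 0 hv) (gaussianPiPDFReal_le 0 v) (gaussianPi_eq_withDensity hv) ?_
    (measurable_gaussianPiPDFReal m _) (gaussianPiPDFReal_pos m hwv)
    (lintegral_gaussianPiPDFReal m hwv).le ?_).trans (EReal.coe_le_coe_iff.2 ?_)
  · simp only [log_gaussianPiPDFReal _ hv]
    exact integrable_finsetSum _ fun d _ => hψi d
  · simp only [log_gaussianPiPDFReal _ hwv]
    exact integrable_finsetSum _ fun d _ => hgi d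
  simp only [log_gaussianPiPDFReal _ hv, log_gaussianPiPDFReal _ hwv]
  rw [integral_finsetSum _ fun d _ => hψi d, integral_finsetSum _ fun d _ => hgi d]
  have h1 : ∀ d, ∫ n : Fin D → ℝ, (-(1 / 2 * log (2 * π * v)) -
      (n d - (0 : Fin D → ℝ) d) ^ 2 / (2 * v)) ∂(gaussianPi D v) =
      -(1 / 2 * log (2 * π * v)) - 1 / 2 := by
    intro d
    simp only [Pi.zero_apply, sub_zero]
    rw [integral_sub (integrable_const _) ((hn d).integrable_sq.div_const _), integral_div,
      integral_eval_sq_gaussianPi, integral_const]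
    simp only [probReal_univ, one_smul]
    field_simp
  have h2 : ∀ d, ∫ q : (Fin D → ℝ) × (Fin D → ℝ), (-(1 / 2 * log (2 * π * (w + v : ℝ≥0))) -
      ((q.1 + q.2) d - m d) ^ 2 / (2 * (w + v : ℝ≥0))) ∂(μ.prod (gaussianPi D v)) =
      -(1 / 2 * log (2 * π * (w + v : ℝ≥0))) -
      (variance (fun x : Fin D → ℝ => x d) μ + v) / (2 * (w + v : ℝ≥0)) := by
    intro d
    simp only [hsum]
    rw [integral_sub (integrable_const _)
      ((memLp_two_fst_add_snd (hc d) (hn d)).integrable_sq.div_const _), integral_div,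
      integral_fst_add_snd_sq (hc d) (hn d) (integral_eval_gaussianPi v d),
      integral_eval_sq_gaussianPi, integral_const,
      variance_eq_integral (measurable_pi_apply d).aemeasurable]
    simp [m]
  simp only [h1, h2, Finset.sum_sub_distrib, Finset.sum_const, Finset.card_univ, Fintype.card_fin,
    nsmul_eq_mul, ← Finset.sum_div, Finset.sum_add_distrib]
  rw [NNReal.coe_add]
  have hlog : log (1 + w / v) = log (2 * π * (w + v)) - log (2 * π * v) := by
    rw [← log_div (by positivity) (by positivity)]
    congr 1
    field_simp
    ring
  have hpow : (∑ d, variance (fun x : Fin D → ℝ => x d) μ + D * v) / (2 * (w + v)) ≤ D / 2 := by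
    rw [div_le_div_iff₀ (by positivity) two_pos]
    linarith
  rw [hlog]
  linarith

/-- A Gaussian source of variance `w` leaks at least the Gaussian amount through every noise of
power `v`. -/
lemma le_leakage_gaussianPi (hv : v ≠ 0) (hw : w ≠ 0)
    (hμ : ∀ d, MemLp (fun x : Fin D → ℝ => x d) 2 μ)
    (hvar : ∑ d, variance (fun x : Fin D → ℝ => x d) μ ≤ D * v) :
    ((D / 2 * log (1 + w / v) : ℝ) : EReal) ≤ leakage (gaussianPi D w) μ := by
  have hv' : (0 : ℝ) < v := NNReal.coe_pos.2 (pos_iff_ne_zero.2 hv)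
  have hw' : (0 : ℝ) < w := NNReal.coe_pos.2 (pos_iff_ne_zero.2 hw)
  set s : ℝ≥0 := w * v / (w + v) with hs
  have hs0 : s ≠ 0 := by positivity
  have hs' : (s : ℝ) = w * v / (w + v) := by simp [hs]
  have hs0' : (0 : ℝ) < s := NNReal.coe_pos.2 (pos_iff_ne_zero.2 hs0)
  set a : ℝ := w / (w + v) with ha
  set m : Fin D → ℝ := fun d => ∫ x, x d ∂μ
  set g : (Fin D → ℝ) × (Fin D → ℝ) → ℝ := fun z =>
    gaussianPiPDFReal (fun d => a * (z.2 d - m d)) s z.1 / gaussianPiPDFReal 0 w z.1 with hg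
  have hgm : Measurable g := by
    refine Measurable.div ?_ ((measurable_gaussianPiPDFReal 0 w).comp measurable_fst)
    exact (measurable_gaussianPiPDFReal_uncurry s).comp
      (f := fun z : (Fin D → ℝ) × (Fin D → ℝ) => (fun d => a * (z.2 d - m d), z.1)) (by fun_prop)
  have hg0 : ∀ z, 0 < g z := fun z =>
    div_pos (gaussianPiPDFReal_pos _ hs0 _) (gaussianPiPDFReal_pos _ hw _)
  have hT : Measurable fun q : (Fin D → ℝ) × (Fin D → ℝ) => (q.1, q.1 + q.2) := by fun_prop
  have hA : Measurable fun q : (Fin D → ℝ) × (Fin D → ℝ) => q.1 + q.2 := by fun_prop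
  rw [leakage_eq_klDiv]
  have := Measure.isProbabilityMeasure_map (μ := (gaussianPi D w).prod μ) hT.aemeasurable
  have := Measure.isProbabilityMeasure_map (μ := (gaussianPi D w).prod μ) hA.aemeasurable
  have hg1 : ∫⁻ z, ENNReal.ofReal (g z) ∂((gaussianPi D w).prod
      (((gaussianPi D w).prod μ).map fun q => q.1 + q.2)) ≤ 1 := by
    rw [lintegral_prod_symm _ (by fun_prop)]
    simp only [hg, lintegral_gaussianPi_div hs0 hw]
    simp
  have hx := memLp_eval_gaussianPi (D := D) w
  have hc : ∀ d, MemLp (fun x : Fin D → ℝ => -a * (x d - m d)) 2 μ := fun d =>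
    (memLp_eval_sub_integral hμ d).const_mul _
  have hc0 : ∀ d, ∫ x : Fin D → ℝ, -a * (x d - m d) ∂μ = 0 := fun d => by
    rw [integral_const_mul, integral_eval_sub_integral hμ, mul_zero]
  have hb : ∀ d, MemLp (fun x : Fin D → ℝ => (1 - a) * x d) 2 (gaussianPi D w) := fun d =>
    (hx d).const_mul _
  have hlog : ∀ q : (Fin D → ℝ) × (Fin D → ℝ), log (g (q.1, q.1 + q.2)) =
      ∑ d, (1 / 2 * log (1 + w / v) - ((1 - a) * q.1 d + -a * (q.2 d - m d)) ^ 2 / (2 * s) +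
        q.1 d ^ 2 / (2 * w)) := by
    intro q
    rw [hg, log_div (gaussianPiPDFReal_pos _ hs0 _).ne' (gaussianPiPDFReal_pos _ hw _).ne',
      log_gaussianPiPDFReal _ hs0, log_gaussianPiPDFReal _ hw, ← Finset.sum_sub_distrib]
    refine Finset.sum_congr rfl fun d _ => ?_
    have h1 : log (1 + w / v) = log (2 * π * w) - log (2 * π * s) := by
      rw [← log_div (by positivity) (by positivity), hs']
      congr 1
      field_simp
      ring
    rw [h1]
    simp only [Pi.add_apply, Pi.zero_apply]
    ring
  have hi1 : ∀ d, Integrable (fun q : (Fin D → ℝ) × (Fin D → ℝ) =>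
      ((1 - a) * q.1 d + -a * (q.2 d - m d)) ^ 2 / (2 * s)) ((gaussianPi D w).prod μ) := fun d =>
    (memLp_two_fst_add_snd (hb d) (hc d)).integrable_sq.div_const _
  have hi2 : ∀ d, Integrable (fun q : (Fin D → ℝ) × (Fin D → ℝ) => q.1 d ^ 2 / (2 * w))
      ((gaussianPi D w).prod μ) := fun d => ((hx d).integrable_sq.div_const _).comp_fst μ
  have hi3 : ∀ d, Integrable (fun q : (Fin D → ℝ) × (Fin D → ℝ) => 1 / 2 * log (1 + w / v) -
      ((1 - a) * q.1 d + -a * (q.2 d - m d)) ^ 2 / (2 * s)) ((gaussianPi D w).prod μ) := fun d =>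
    (integrable_const _).sub (hi1 d)
  have hi : ∀ d, Integrable (fun q : (Fin D → ℝ) × (Fin D → ℝ) => 1 / 2 * log (1 + w / v) -
      ((1 - a) * q.1 d + -a * (q.2 d - m d)) ^ 2 / (2 * s) + q.1 d ^ 2 / (2 * w))
      ((gaussianPi D w).prod μ) := fun d => (hi3 d).add (hi2 d)
  refine le_trans (EReal.coe_le_coe_iff.2 ?_) (integral_log_le_klDiv hgm hg0 hg1 ?_)
  · rw [integral_map hT.aemeasurable hgm.log.aestronglyMeasurable]
    simp only [hlog]
    rw [integral_finsetSum _ fun d _ => hi d]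
    have h : ∀ d, ∫ q : (Fin D → ℝ) × (Fin D → ℝ), (1 / 2 * log (1 + w / v) -
        ((1 - a) * q.1 d + -a * (q.2 d - m d)) ^ 2 / (2 * s) + q.1 d ^ 2 / (2 * w))
        ∂((gaussianPi D w).prod μ) = 1 / 2 * log (1 + w / v) - ((1 - a) ^ 2 * w +
          a ^ 2 * variance (fun x : Fin D → ℝ => x d) μ) / (2 * s) + 1 / 2 := by
      intro d
      have hvar_eq : variance (fun x : Fin D → ℝ => x d) μ = ∫ x, (x d - m d) ^ 2 ∂μ :=
        variance_eq_integral (measurable_pi_apply d).aemeasurable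
      rw [integral_add (hi3 d) (hi2 d), integral_sub (integrable_const _) (hi1 d), integral_div,
        integral_fst_add_snd_sq (hb d) (hc d) (hc0 d),
        integral_fun_fst (fun x : Fin D → ℝ => x d ^ 2 / (2 * (w : ℝ))), integral_div,
        integral_eval_sq_gaussianPi, hvar_eq]
      simp only [mul_pow, integral_const_mul, integral_eval_sq_gaussianPi, integral_const,
        probReal_univ, one_smul, neg_sq]
      field_simp
    simp only [h, Finset.sum_sub_distrib, Finset.sum_const, Finset.card_univ, Fintype.card_fin,
      nsmul_eq_mul, ← Finset.sum_div, Finset.sum_add_distrib, ← Finset.mul_sum]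
    have hle : (D * ((1 - a) ^ 2 * w) + a ^ 2 * ∑ d, variance (fun x : Fin D → ℝ => x d) μ) /
        (2 * s) ≤ D / 2 := by
      have h1 : (1 - a) ^ 2 * w + a ^ 2 * v = s := by
        rw [hs', ha]
        field_simp
        ring
      have h2 := mul_le_mul_of_nonneg_left hvar (sq_nonneg a)
      rw [div_le_div_iff₀ (by positivity) two_pos, ← h1]
      linarith
    linarith
  · rw [integrable_map_measure hgm.log.aestronglyMeasurable hT.aemeasurable]
    simp only [Function.comp_def, hlog]
    exact integrable_finsetSum _ fun d _ => hi d

end GaussianSaddlePoint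

lemma iSup_iInf_eq_of_saddlePoint {ι κ α : Type*} [CompleteLattice α] {f : ι → κ → α} {c : α}
    (i₀ : ι) (j₀ : κ) (hle : ∀ i, f i j₀ ≤ c) (hge : ∀ j, c ≤ f i₀ j) :
    ⨆ i, ⨅ j, f i j = c :=
  le_antisymm (iSup_le fun i => (iInf_le _ j₀).trans (hle i))
    ((le_iInf hge).trans (le_iSup (fun i => ⨅ j, f i j) i₀))

/-- **Maximal peer-to-peer information leakage.**
With sources constrained by `Tr Cov(X) ≤ D ζ²` and noises constrained by
`Tr Cov(N) ≤ D λ²`, the sup-inf of `I(X; X + N)` equals `(D/2)·ln(1 + ζ²/λ²)` nats;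
consequently, over an erasure link delivering the masked update with probability
`1 - p`, the maximal leakage `(1 - p)·I(X; X + N)` has sup-inf value
`(1 - p)·(D/2)·ln(1 + ζ²/λ²)` nats. -/
theorem supInf_leakage (D : ℕ) (hD : 1 ≤ D) (ζ lam p : ℝ) (hζ : 0 < ζ) (hlam : 0 < lam)
    (hp : p ∈ Set.Icc (0 : ℝ) 1) :
    (⨆ μX : PowerConstrained D (ζ ^ 2), ⨅ μN : PowerConstrained D (lam ^ 2),
        leakage μX.1 μN.1) =
      (((D : ℝ) / 2 * Real.log (1 + ζ ^ 2 / lam ^ 2) : ℝ) : EReal) ∧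
    (⨆ μX : PowerConstrained D (ζ ^ 2), ⨅ μN : PowerConstrained D (lam ^ 2),
        ((1 - p : ℝ) : EReal) * leakage μX.1 μN.1) =
      (((1 - p) * ((D : ℝ) / 2 * Real.log (1 + ζ ^ 2 / lam ^ 2)) : ℝ) : EReal) := by
  have hζ2 : ((ζ ^ 2).toNNReal : ℝ) = ζ ^ 2 := Real.coe_toNNReal _ (sq_nonneg ζ)
  have hlam2 : ((lam ^ 2).toNNReal : ℝ) = lam ^ 2 := Real.coe_toNNReal _ (sq_nonneg lam)
  have hw : (ζ ^ 2).toNNReal ≠ 0 := (Real.toNNReal_pos.2 (by positivity)).ne'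
  have hv : (lam ^ 2).toNNReal ≠ 0 := (Real.toNNReal_pos.2 (by positivity)).ne'
  let X : PowerConstrained D (ζ ^ 2) := ⟨gaussianPi D (ζ ^ 2).toNNReal, inferInstance,
    memLp_eval_gaussianPi _, by rw [sum_variance_gaussianPi, hζ2]⟩
  let N : PowerConstrained D (lam ^ 2) := ⟨gaussianPi D (lam ^ 2).toNNReal, inferInstance,
    memLp_eval_gaussianPi _, by rw [sum_variance_gaussianPi, hlam2]⟩
  have hle : ∀ μX : PowerConstrained D (ζ ^ 2), leakage μX.1 N.1 ≤
      (((D : ℝ) / 2 * Real.log (1 + ζ ^ 2 / lam ^ 2) : ℝ) : EReal) := by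
    rintro ⟨μ, hμ, hL, hvar⟩
    have h := leakage_gaussianPi_le hv hL (hvar.trans_eq (congrArg _ hζ2.symm))
    rwa [hζ2, hlam2] at h
  have hge : ∀ μN : PowerConstrained D (lam ^ 2),
      (((D : ℝ) / 2 * Real.log (1 + ζ ^ 2 / lam ^ 2) : ℝ) : EReal) ≤ leakage X.1 μN.1 := by
    rintro ⟨μ, hμ, hL, hvar⟩
    have h := le_leakage_gaussianPi hv hw hL (hvar.trans_eq (congrArg _ hlam2.symm))
    rwa [hζ2, hlam2] at h
  have hp0 : (0 : EReal) ≤ ((1 - p : ℝ) : EReal) := EReal.coe_nonneg.2 (sub_nonneg.2 hp.2)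
  refine ⟨iSup_iInf_eq_of_saddlePoint X N hle hge, ?_⟩
  rw [EReal.coe_mul]
  exact iSup_iInf_eq_of_saddlePoint X N (fun μX => mul_le_mul_of_nonneg_left (hle μX) hp0)
    fun μN => mul_le_mul_of_nonneg_left (hge μN) hp0
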